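/- arXiv:0802.2544 — 3 statements merged into one kernel-verified Lean document; each statement's English description precedes it below -/
import Mathlib

section
/- For t, s ∈ (1,∞), the Lie algebras (ℝ⁹, μ_t) and (ℝ⁹, μ_s) are isomorphic if and only if t = s. -/
open Matrix Finset Real Filter

noncomputable section

/-- The canonical basis vector `eᵢ` of `ℝ⁹` (0-indexed: `e 0 = e₁`, …, `e 8 = e₉`). -/
def e (i : Fin 9) : Fin 9 → ℝ := Pi.single i 1

/-- Half of the structure constants of `μ_t` (before antisymmetrization):
`μ_t(e₅,e₄)=e₇, μ_t(e₁,e₆)=e₈, μ_t(e₃,e₂)=e₉, μ_t(e₃,e₆)=t e₇, μ_t(e₅,e₂)=t e₈, μ_t(e₁,e₄)=t e₉`. -/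
def muHalf (t : ℝ) (i j k : Fin 9) : ℝ :=
  (if i = 4 ∧ j = 3 ∧ k = 6 then (1:ℝ) else 0) +
  (if i = 0 ∧ j = 5 ∧ k = 7 then (1:ℝ) else 0) +
  (if i = 2 ∧ j = 1 ∧ k = 8 then (1:ℝ) else 0) +
  (if i = 2 ∧ j = 5 ∧ k = 6 then t else 0) +
  (if i = 4 ∧ j = 1 ∧ k = 7 then t else 0) +
  (if i = 0 ∧ j = 3 ∧ k = 8 then t else 0)

/-- The (antisymmetric) structure constants of `μ_t`. -/
def muC (t : ℝ) (i j k : Fin 9) : ℝ := muHalf t i j k - muHalf t j i k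

/-- The two-step nilpotent Lie bracket `μ_t` on `ℝ⁹`. -/
def mu (t : ℝ) (X Y : Fin 9 → ℝ) : Fin 9 → ℝ :=
  fun k => ∑ i, ∑ j, X i * Y j * muC t i j k

/-- Structure constants of `μ̃_t`: those of `μ_t` plus `μ̃_t(e₁,e₂)=e₇`. -/
def muTildeHalf (t : ℝ) (i j k : Fin 9) : ℝ :=
  muHalf t i j k + (if i = 0 ∧ j = 1 ∧ k = 6 then (1:ℝ) else 0)

def muTildeC (t : ℝ) (i j k : Fin 9) : ℝ := muTildeHalf t i j k - muTildeHalf t j i k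

/-- The two-step nilpotent Lie bracket `μ̃_t` on `ℝ⁹`. -/
def muTilde (t : ℝ) (X Y : Fin 9 → ℝ) : Fin 9 → ℝ :=
  fun k => ∑ i, ∑ j, X i * Y j * muTildeC t i j k

/-- Structure constants of `μ̄_t`: those of `μ̃_t` plus `μ̄_t(e₃,e₄)=e₈`. -/
def muBarHalf (t : ℝ) (i j k : Fin 9) : ℝ :=
  muTildeHalf t i j k + (if i = 2 ∧ j = 3 ∧ k = 7 then (1:ℝ) else 0)

def muBarC (t : ℝ) (i j k : Fin 9) : ℝ := muBarHalf t i j k - muBarHalf t j i k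

/-- The two-step nilpotent Lie bracket `μ̄_t` on `ℝ⁹`. -/
def muBar (t : ℝ) (X Y : Fin 9 → ℝ) : Fin 9 → ℝ :=
  fun k => ∑ i, ∑ j, X i * Y j * muBarC t i j k

/-- The space of (skew-symmetric bilinear) bracket candidates on `ℝ⁹`,
represented as bare functions. -/
abbrev NilBracket := (Fin 9 → ℝ) → (Fin 9 → ℝ) → Fin 9 → ℝ

/-- The Ricci operator of `(ℝ⁹, ν)` w.r.t. the canonical inner product, as a matrix in the
canonical basis:
`⟨Ric_ν X, Y⟩ = -(1/2)∑ᵢⱼ⟨ν(X,eᵢ),eⱼ⟩⟨ν(Y,eᵢ),eⱼ⟩ + (1/4)∑ᵢⱼ⟨ν(eᵢ,eⱼ),X⟩⟨ν(eᵢ,eⱼ),Y⟩`. -/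
def ric (ν : NilBracket) : Matrix (Fin 9) (Fin 9) ℝ :=
  fun a b =>
    -(1/2) * (∑ i, ∑ j, ν (e a) (e i) j * ν (e b) (e i) j)
    + (1/4) * (∑ i, ∑ j, ν (e i) (e j) a * ν (e i) (e j) b)

/-- `D` is a derivation of the algebra `(ℝ⁹, ν)`. -/
def IsDerivation (ν : NilBracket) (D : Matrix (Fin 9) (Fin 9) ℝ) : Prop :=
  ∀ X Y : Fin 9 → ℝ, D.mulVec (ν X Y) = ν (D.mulVec X) Y + ν X (D.mulVec Y)

/-- The basis `e₁,…,e₆` of `v = span(e₁,…,e₆) ⊆ ℝ⁹`, indexed by `Fin 6`. -/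
def E (a : Fin 6) : Fin 9 → ℝ := e (Fin.castLE (by norm_num) a)

/-- The skew-symmetric 6×6 matrix `J_ν(w)`, `w = x e₇ + y e₈ + z e₉`, defined by
`⟨J_ν(w) v₁, v₂⟩ = ⟨ν(v₁,v₂), w⟩` for `v₁,v₂ ∈ span(e₁,…,e₆)`. -/
def Jmat (ν : NilBracket) (x y z : ℝ) : Matrix (Fin 6) (Fin 6) ℝ :=
  fun a b => ν (E b) (E a) 6 * x + ν (E b) (E a) 7 * y + ν (E b) (E a) 8 * z

/-- The `GL₉(ℝ)` action on brackets: `(g·ν)(X,Y) = g ν(g⁻¹X, g⁻¹Y)`. -/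
def act (g : Matrix (Fin 9) (Fin 9) ℝ) (ν : NilBracket) : NilBracket :=
  fun X Y => g.mulVec (ν (g⁻¹.mulVec X) (g⁻¹.mulVec Y))

/-- The algebras `(ℝ⁹, ν)` and `(ℝ⁹, ν')` are isomorphic:
there is `g ∈ GL₉(ℝ)` with `g ν(X,Y) = ν'(gX, gY)` for all `X, Y`. -/
def LieIso (ν ν' : NilBracket) : Prop :=
  ∃ g : Matrix (Fin 9) (Fin 9) ℝ, IsUnit g ∧
    ∀ X Y : Fin 9 → ℝ, g.mulVec (ν X Y) = ν' (g.mulVec X) (g.mulVec Y)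

/-- The index of the odd basis vector `e₁, e₃, e₅`. -/
def oddIdx (j : Fin 3) : Fin 9 := ⟨2 * j, by omega⟩

/-- The index of the even basis vector `e₂, e₄, e₆`. -/
def evenIdx (j : Fin 3) : Fin 9 := ⟨2 * j + 1, by omega⟩

/-- The index of the central basis vector `e₇, e₈, e₉`. -/
def centIdx (j : Fin 3) : Fin 9 := ⟨6 + j, by omega⟩

lemma mu_apply_six (t : ℝ) (X Y : Fin 9 → ℝ) :
    mu t X Y 6 = (X 4 * Y 3 - X 3 * Y 4) + t * (X 2 * Y 5 - X 5 * Y 2) := by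
  simp [mu, muC, muHalf, mul_sub, mul_add, Finset.sum_add_distrib, ite_and]; ring

lemma mu_apply_seven (t : ℝ) (X Y : Fin 9 → ℝ) :
    mu t X Y 7 = (X 0 * Y 5 - X 5 * Y 0) + t * (X 4 * Y 1 - X 1 * Y 4) := by
  simp [mu, muC, muHalf, mul_sub, mul_add, Finset.sum_add_distrib, ite_and]; ring

lemma mu_apply_eight (t : ℝ) (X Y : Fin 9 → ℝ) :
    mu t X Y 8 = (X 2 * Y 1 - X 1 * Y 2) + t * (X 0 * Y 3 - X 3 * Y 0) := by
  simp [mu, muC, muHalf, mul_sub, mul_add, Finset.sum_add_distrib, ite_and]; ring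

lemma mu_apply_of_lt (t : ℝ) (X Y : Fin 9 → ℝ) {k : Fin 9} (hk : k < 6) :
    mu t X Y k = 0 := by
  have h6 : k ≠ 6 := hk.ne
  have h7 : k ≠ 7 := (hk.trans (by decide)).ne
  have h8 : k ≠ 8 := (hk.trans (by decide)).ne
  simp [mu, muC, muHalf, h6, h7, h8]

/-- The cyclic description of `μ_t`: the component along `z_{j+2}` pairs the `j`-th and the
`(j+1)`-st coordinate planes. -/
lemma mu_apply_centIdx (t : ℝ) (X Y : Fin 9 → ℝ) (j : Fin 3) :
    mu t X Y (centIdx (j + 2)) =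
      (t * X (oddIdx j) * Y (evenIdx (j + 1)) - X (evenIdx j) * Y (oddIdx (j + 1))) -
      (t * Y (oddIdx j) * X (evenIdx (j + 1)) - Y (evenIdx j) * X (oddIdx (j + 1))) := by
  fin_cases j
  · exact (mu_apply_eight t X Y).trans (by simp [oddIdx, evenIdx]; ring)
  · exact (mu_apply_six t X Y).trans (by simp [oddIdx, evenIdx]; ring)
  · exact (mu_apply_seven t X Y).trans (by simp [oddIdx, evenIdx]; ring)

/-- Multiplication by `g` is a homomorphism of algebras from `ν` to `ν'`. -/
def IsBracketHom (g : Matrix (Fin 9) (Fin 9) ℝ) (ν ν' : NilBracket) : Prop :=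
  ∀ X Y : Fin 9 → ℝ, g.mulVec (ν X Y) = ν' (g.mulVec X) (g.mulVec Y)

lemma mulVec_mu_apply (g : Matrix (Fin 9) (Fin 9) ℝ) (t : ℝ) (X Y : Fin 9 → ℝ) (k : Fin 9) :
    g.mulVec (mu t X Y) k = ∑ i, g k (centIdx i) * mu t X Y (centIdx i) := by
  have h : ∀ i : Fin 6, mu t X Y (Fin.castAdd 3 i) = 0 := fun i =>
    mu_apply_of_lt t X Y (by simp [Fin.lt_def])
  calc g.mulVec (mu t X Y) k = ∑ i : Fin (6 + 3), g k i * mu t X Y i := rfl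
    _ = _ := by
      rw [Fin.sum_univ_add]
      simp only [h, mul_zero, Finset.sum_const_zero, zero_add]
      rfl

lemma IsBracketHom.apply_centIdx {g : Matrix (Fin 9) (Fin 9) ℝ} {t s : ℝ}
    (hg : IsBracketHom g (mu t) (mu s)) (X Y : Fin 9 → ℝ) (k : Fin 9) :
    mu s (g.mulVec X) (g.mulVec Y) k = ∑ i, g k (centIdx i) * mu t X Y (centIdx i) := by
  rw [← hg X Y, mulVec_mu_apply]

/-- A homomorphism preserves the span of the central basis vectors. -/
lemma IsBracketHom.apply_eq_zero {g : Matrix (Fin 9) (Fin 9) ℝ} {t s : ℝ}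
    (hg : IsBracketHom g (mu t) (mu s)) {k : Fin 9} (hk : k < 6) (i : Fin 3) :
    g k (centIdx i) = 0 := by
  have h0 := fun X Y => (hg.apply_centIdx X Y k).symm.trans (mu_apply_of_lt s _ _ hk)
  simp only [Fin.sum_univ_three] at h0
  have h1 := h0 (e 4) (e 3)
  have h2 := h0 (e 0) (e 5)
  have h3 := h0 (e 2) (e 1)
  rw [show centIdx 0 = 6 from rfl, show centIdx 1 = 7 from rfl,
    show centIdx 2 = 8 from rfl, mu_apply_six, mu_apply_seven, mu_apply_eight] at h1 h2 h3
  simp [e] at h1 h2 h3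
  fin_cases i
  exacts [h1, h2, h3]

/-- If a product of three linear forms in two variables vanishes, one of the forms vanishes. -/
lemma exists_form_eq_zero (b c : Fin 3 → ℝ)
    (h : ∀ y z : ℝ, (y * b 0 + z * c 0) * (y * b 1 + z * c 1) * (y * b 2 + z * c 2) = 0) :
    ∃ i, b i = 0 ∧ c i = 0 := by
  have h1 := h 1 0
  have h2 := h 0 1
  have h3 := h 1 1
  have h4 := h 1 (-1)
  by_contra! hne
  have n0 := hne 0
  have n1 := hne 1
  have n2 := hne 2
  have h5 := h 1 2
  grind

/-- A linear form on the centre whose associated 2-form is degenerate has a zero coordinate. -/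
lemma prod_eq_zero_of_degenerate {t : ℝ} (ht : 1 < t) (l : Fin 3 → ℝ) (X : Fin 9 → ℝ)
    (hX : ∃ k < 6, X k ≠ 0) (h : ∀ Y, ∑ i, l i * mu t X Y (centIdx i) = 0) :
    l 0 * l 1 * l 2 = 0 := by
  simp only [Fin.sum_univ_three] at h
  simp only [show centIdx 0 = 6 from rfl, show centIdx 1 = 7 from rfl,
    show centIdx 2 = 8 from rfl, mu_apply_six, mu_apply_seven, mu_apply_eight] at h
  have h0 := h (e 0)
  have h1 := h (e 1)
  have h2 := h (e 2)
  have h3 := h (e 3)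
  have h4 := h (e 4)
  have h5 := h (e 5)
  simp [e] at h0 h1 h2 h3 h4 h5
  have hpos : (1 + t ^ 3) ≠ 0 := by positivity
  obtain ⟨k, hk, hXk⟩ := hX
  have key : (1 + t ^ 3) * (l 0 * l 1 * l 2) * X k = 0 := by
    fin_cases k
    · change (1 + t ^ 3) * (l 0 * l 1 * l 2) * X 0 = 0
      linear_combination t ^ 2 * l 0 * l 1 * h3 - t * (l 0) ^ 2 * h1 + l 0 * l 2 * h5
    · change (1 + t ^ 3) * (l 0 * l 1 * l 2) * X 1 = 0
      linear_combination -(t ^ 2 * l 2 * l 0 * h4 - t * (l 0) ^ 2 * h0 + l 0 * l 1 * h2)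
    · change (1 + t ^ 3) * (l 0 * l 1 * l 2) * X 2 = 0
      linear_combination t ^ 2 * l 1 * l 2 * h5 - t * l 1 ^ 2 * h3 + l 1 * l 0 * h1
    · change (1 + t ^ 3) * (l 0 * l 1 * l 2) * X 3 = 0
      linear_combination -(t ^ 2 * l 0 * l 1 * h0 - t * l 1 ^ 2 * h2 + l 1 * l 2 * h4)
    · change (1 + t ^ 3) * (l 0 * l 1 * l 2) * X 4 = 0
      linear_combination t ^ 2 * l 2 * l 0 * h1 - t * l 2 ^ 2 * h5 + l 2 * l 1 * h3
    · change (1 + t ^ 3) * (l 0 * l 1 * l 2) * X 5 = 0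
      linear_combination -(t ^ 2 * l 1 * l 2 * h2 - t * l 2 ^ 2 * h4 + l 2 * l 0 * h0)
    all_goals exact absurd hk (by decide)
  simpa [hpos, hXk] using key

/-- If a linear form on the centre has a zero coordinate, its associated 2-form is degenerate. -/
lemma exists_degenerate (s : ℝ) (hs : 1 < s) (w : Fin 3 → ℝ) (j : Fin 3) (hj : w j = 0)
    (hw : w ≠ 0) :
    ∃ X : Fin 9 → ℝ, (∃ k < 6, X k ≠ 0) ∧ ∀ Y, ∑ i, w i * mu s X Y (centIdx i) = 0 := by
  have hs0 : s ≠ 0 := by positivity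
  have hsum : ∀ f : Fin 3 → ℝ, ∑ i, f i = f (j + 2) + f (j + 1 + 2) + f (j + 2 + 2) := by
    intro f
    fin_cases j <;> simp [Fin.sum_univ_three] <;> ring
  refine ⟨(s * w (j + 1)) • e (oddIdx (j + 1)) - w (j + 2) • e (oddIdx (j + 2)), ?_, ?_⟩
  · by_contra! hcon
    apply hw
    have h1 := hcon (oddIdx (j + 1)) (by fin_cases j <;> decide)
    have h2 := hcon (oddIdx (j + 2)) (by fin_cases j <;> decide)
    ext i
    fin_cases j <;> fin_cases i <;> simp_all [e, oddIdx]
  · intro Y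
    rw [hsum, mu_apply_centIdx, mu_apply_centIdx, mu_apply_centIdx]
    fin_cases j <;> simp_all [e, oddIdx, evenIdx] <;> ring

/-- An injective self-map of `Fin 3` is a rotation or a reflection. -/
lemma rotation_or_reflection : ∀ σ : Fin 3 → Fin 3, Function.Injective σ →
    (∀ j, σ (j + 1) = σ j + 1) ∨ (∀ j, σ j = σ (j + 1) + 1) := by
  decide

/-- Up to scalars, an isomorphism permutes the three coordinate forms on the centre. -/
lemma exists_perm {g h : Matrix (Fin 9) (Fin 9) ℝ} {t s : ℝ} (ht : 1 < t) (hs : 1 < s)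
    (hg : IsBracketHom g (mu t) (mu s))
    (hgh : g * h = 1) (hhg : h * g = 1) :
    ∃ (σ : Fin 3 → Fin 3) (c : Fin 3 → ℝ), Function.Injective σ ∧ (∀ j, c j ≠ 0) ∧
      ∀ j X Y, mu s (g.mulVec X) (g.mulVec Y) (centIdx j) = c j * mu t X Y (centIdx (σ j)) := by
  have hsplit : ∀ f : Fin 9 → ℝ,
      ∑ i, f i = ∑ i : Fin 6, f (Fin.castAdd 3 i) + ∑ i, f (centIdx i) :=
    fun f => Fin.sum_univ_add (a := 6) (b := 3) f
  have hlt : ∀ i : Fin 6, (Fin.castAdd 3 i : Fin 9) < 6 := by decide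
  have hcol : ∀ i, ∃ j, g (centIdx j) (centIdx i) ≠ 0 := by
    intro i
    by_contra! hcon
    have h1 := congrFun (congrFun hhg (centIdx i)) (centIdx i)
    rw [Matrix.mul_apply, hsplit] at h1
    simp [hcon, hg.apply_eq_zero (hlt _)] at h1
  have hnoncentral : ∀ X : Fin 9 → ℝ, (∃ k < 6, X k ≠ 0) →
      ∃ k < 6, h.mulVec X k ≠ 0 := by
    rintro X ⟨k, hk, hXk⟩
    by_contra! hcon
    apply hXk
    have h1 : g.mulVec (h.mulVec X) k = X k := by simp [Matrix.mulVec_mulVec, hgh]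
    rw [← h1]
    change ∑ i, g k i * h.mulVec X i = 0
    rw [hsplit]
    simp [hcon _ (hlt _), hg.apply_eq_zero hk]
  have hprod : ∀ (w : Fin 3 → ℝ) (j : Fin 3), w j = 0 →
      (∑ k, w k * g (centIdx k) (centIdx 0)) * (∑ k, w k * g (centIdx k) (centIdx 1)) *
        (∑ k, w k * g (centIdx k) (centIdx 2)) = 0 := by
    intro w j hj
    by_cases hw : w = 0
    · simp [hw]
    obtain ⟨X, hX, hrad⟩ := exists_degenerate s hs w j hj hw
    refine prod_eq_zero_of_degenerate ht (fun i => ∑ k, w k * g (centIdx k) (centIdx i))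
      (h.mulVec X) (hnoncentral X hX) fun Y => ?_
    rw [← hrad (g.mulVec Y)]
    have h1 : X = g.mulVec (h.mulVec X) := by simp [Matrix.mulVec_mulVec, hgh]
    conv_rhs => rw [h1]
    simp only [hg.apply_centIdx, Finset.sum_mul, Finset.mul_sum]
    rw [Finset.sum_comm]
    simp only [mul_assoc]
  have hσ : ∀ j, ∃ i, ∀ k, k ≠ j → g (centIdx k) (centIdx i) = 0 := by
    intro j
    obtain ⟨i, h1, h2⟩ := exists_form_eq_zero
      (fun i => g (centIdx (j + 1)) (centIdx i)) (fun i => g (centIdx (j + 2)) (centIdx i)) (by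
        intro y z
        have := hprod (Pi.single (j + 1) y + Pi.single (j + 2) z) j (by
          fin_cases j <;> simp)
        simpa [add_mul, Finset.sum_add_distrib, Pi.single_apply] using this)
    refine ⟨i, fun k hk => ?_⟩
    have hk' : ∀ j k : Fin 3, k ≠ j → k = j + 1 ∨ k = j + 2 := by decide
    rcases hk' j k hk with rfl | rfl
    exacts [h1, h2]
  choose σ hσ using hσ
  have hne : ∀ j, g (centIdx j) (centIdx (σ j)) ≠ 0 := by
    intro j
    obtain ⟨k, hk⟩ := hcol (σ j)
    by_cases hkj : k = j
    · rwa [← hkj] at hk ⊢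
    · exact absurd (hσ j k hkj) hk
  have hinj : Function.Injective σ := by
    intro j j' hjj
    by_contra hcon
    exact hne j (by rw [hjj]; exact hσ j' j hcon)
  refine ⟨σ, fun j => g (centIdx j) (centIdx (σ j)), hinj, hne, fun j X Y => ?_⟩
  rw [hg.apply_centIdx]
  refine Finset.sum_eq_single _ (fun i _ hi => ?_) (by simp)
  obtain ⟨j', rfl⟩ := (Finite.injective_iff_surjective.mp hinj) i
  rw [hσ j' j (fun hcon => hi (by rw [hcon])), zero_mul]

/-- If the cyclically consecutive members of a family of vectors `(a j, b j)` are isotropic for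
`s x₁ y₂ - x₂ y₁`, the vectors are all on the same coordinate axis. -/
lemma isotropic_cycle {s : ℝ} (hs : 1 < s) (a b : Fin 3 → ℝ)
    (hne : ∀ j, a j ≠ 0 ∨ b j ≠ 0)
    (h : ∀ j, s * a j * b (j + 1) - b j * a (j + 1) = 0) :
    (∀ j, a j = 0 ∧ b j ≠ 0) ∨ (∀ j, a j ≠ 0 ∧ b j = 0) := by
  have h0 : s * a 0 * b 1 - b 0 * a 1 = 0 := h 0
  have h1 : s * a 1 * b 2 - b 1 * a 2 = 0 := h 1
  have h2 : s * a 2 * b 0 - b 2 * a 0 = 0 := h 2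
  have n0 := hne 0
  have n1 := hne 1
  have n2 := hne 2
  have hs3 : s ^ 3 - 1 ≠ 0 := by
    have := one_lt_pow₀ hs (n := 3) (by norm_num)
    linarith
  have hs0 : s ≠ 0 := by positivity
  have hprod : (s ^ 3 - 1) * (a 0 * a 1 * a 2 * (b 0 * b 1 * b 2)) = 0 := by
    linear_combination (s * a 1 * b 2) * (s * a 2 * b 0) * h0
      + (b 0 * a 1) * (s * a 2 * b 0) * h1 + (b 0 * a 1) * (b 1 * a 2) * h2
  simp only [Fin.forall_fin_succ, Fin.forall_fin_zero]
  simp only [mul_eq_zero, hs3, false_or] at hprod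
  simp
  grind

/-- The comparison of the two cyclic systems of bilinear forms. -/
lemma eq_of_cycle {t s : ℝ} (ht : 1 < t) (hs : 1 < s) (a b a' b' : Fin 3 → ℝ)
    (hu : ∀ j, s * a j * b (j + 1) - b j * a (j + 1) = 0)
    (hw : ∀ j, s * a' j * b' (j + 1) - b' j * a' (j + 1) = 0)
    (huw : ∀ j, s * a j * b' (j + 1) - b j * a' (j + 1) =
      -t * (s * a' j * b (j + 1) - b' j * a (j + 1)))
    (hne : ∀ j, s * a' j * b (j + 1) - b' j * a (j + 1) ≠ 0) : t = s := by
  have hne1 : ∀ j, a j ≠ 0 ∨ b j ≠ 0 := by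
    intro j
    by_contra! hcon
    have := hne (j + 2)
    rw [show j + 2 + 1 = j by fin_cases j <;> rfl] at this
    simp [hcon] at this
  have hne2 : ∀ j, a' j ≠ 0 ∨ b' j ≠ 0 := by
    intro j
    by_contra! hcon
    exact hne j (by simp [hcon])
  have h0 : s * a 0 * b' 1 - b 0 * a' 1 = -t * (s * a' 0 * b 1 - b' 0 * a 1) := huw 0
  have h1 : s * a 1 * b' 2 - b 1 * a' 2 = -t * (s * a' 1 * b 2 - b' 1 * a 2) := huw 1
  have h2 : s * a 2 * b' 0 - b 2 * a' 0 = -t * (s * a' 2 * b 0 - b' 2 * a 0) := huw 2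
  rcases isotropic_cycle hs a b hne1 hu with h | h <;>
    rcases isotropic_cycle hs a' b' hne2 hw with h' | h'
  · exact absurd (by simp [h, h']) (hne 0)
  · exfalso
    simp only [h, h', mul_zero, sub_zero, zero_sub] at h0 h1 h2
    have hP : b 0 * b 1 * b 2 * (a' 0 * a' 1 * a' 2) ≠ 0 := by simp [h, h']
    have h3 : (t * s) ^ 3 = 1 := by
      apply mul_right_cancel₀ hP
      have : (b 0 * a' 1) * (b 1 * a' 2) * (b 2 * a' 0) =
        (t * (s * a' 0 * b 1)) * (t * (s * a' 1 * b 2)) * (t * (s * a' 2 * b 0)) := by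
        rw [show b 0 * a' 1 = t * (s * a' 0 * b 1) by linarith,
          show b 1 * a' 2 = t * (s * a' 1 * b 2) by linarith,
          show b 2 * a' 0 = t * (s * a' 2 * b 0) by linarith]
      linear_combination -this
    have := one_lt_pow₀ (one_lt_mul_of_lt_of_le ht hs.le) (n := 3) (by norm_num)
    linarith
  · simp only [h, h', mul_zero, sub_zero, zero_sub] at h0 h1 h2
    have hP : a 0 * a 1 * a 2 * (b' 0 * b' 1 * b' 2) ≠ 0 := by simp [h, h']
    have h3 : t ^ 3 = s ^ 3 := by
      apply mul_right_cancel₀ hP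
      have : (s * a 0 * b' 1) * (s * a 1 * b' 2) * (s * a 2 * b' 0) =
        (t * (b' 0 * a 1)) * (t * (b' 1 * a 2)) * (t * (b' 2 * a 0)) := by
        rw [h0, h1, h2]; ring
      linear_combination -this
    exact (pow_left_inj₀ (by positivity) (by positivity) (by norm_num)).mp h3
  · exact absurd (by simp [h, h']) (hne 0)

/-- A vector in the radical of the `z_j`-component is supported on the `j`-th plane modulo
the centre. -/
lemma apply_eq_zero_of_mem_radical {s : ℝ} (hs : 1 < s) {X : Fin 9 → ℝ} {j : Fin 3}
    (h : ∀ Y, mu s X Y (centIdx j) = 0) {i : Fin 3} (hi : i ≠ j) :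
    X (oddIdx i) = 0 ∧ X (evenIdx i) = 0 := by
  have hs0 : s ≠ 0 := by positivity
  have h' : ∀ Y, mu s X Y (centIdx (j + 1 + 2)) = 0 := by
    rwa [show j + 1 + 2 = j by fin_cases j <;> rfl]
  simp only [mu_apply_centIdx] at h'
  have h1 := h' (e (oddIdx (j + 1)))
  have h2 := h' (e (evenIdx (j + 1)))
  have h3 := h' (e (oddIdx (j + 2)))
  have h4 := h' (e (evenIdx (j + 2)))
  clear h h'
  fin_cases j <;> fin_cases i <;> simp_all [e, oddIdx, evenIdx]

lemma eq_of_isBracketHom {g h : Matrix (Fin 9) (Fin 9) ℝ} {t s : ℝ} (ht : 1 < t) (hs : 1 < s)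
    (hg : IsBracketHom g (mu t) (mu s))
    (hgh : g * h = 1) (hhg : h * g = 1) : t = s := by
  obtain ⟨σ, c, hinj, hc, hσ⟩ := exists_perm ht hs hg hgh hhg
  have hcol : ∀ k, g.mulVec (e k) = fun i => g i k := by
    intro k
    ext i
    simp [e]
  have hrad : ∀ j X, (∀ Y, mu t X Y (centIdx (σ j)) = 0) →
      ∀ Y, mu s (g.mulVec X) Y (centIdx j) = 0 := by
    intro j X hX Y
    have h1 : Y = g.mulVec (h.mulVec Y) := by simp [Matrix.mulVec_mulVec, hgh]
    rw [h1, hσ, hX, mul_zero]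
  have hradt : ∀ (i : Fin 3) (Y : Fin 9 → ℝ), mu t (e (oddIdx i)) Y (centIdx i) = 0 ∧
      mu t (e (evenIdx i)) Y (centIdx i) = 0 := by
    intro i Y
    have hi : i = i + 1 + 2 := by fin_cases i <;> rfl
    have h1 := mu_apply_centIdx t (e (oddIdx i)) Y (i + 1)
    have h2 := mu_apply_centIdx t (e (evenIdx i)) Y (i + 1)
    rw [← hi] at h1 h2
    rw [h1, h2]
    fin_cases i <;> simp [e, oddIdx, evenIdx]
  have hodd : ∀ i j, i ≠ j →
      g (oddIdx i) (oddIdx (σ j)) = 0 ∧ g (evenIdx i) (oddIdx (σ j)) = 0 := by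
    intro i j hij
    simpa [hcol] using apply_eq_zero_of_mem_radical hs
      (hrad j _ fun Y => (hradt (σ j) Y).1) hij
  have heven : ∀ i j, i ≠ j →
      g (oddIdx i) (evenIdx (σ j)) = 0 ∧ g (evenIdx i) (evenIdx (σ j)) = 0 := by
    intro i j hij
    simpa [hcol] using apply_eq_zero_of_mem_radical hs
      (hrad j _ fun Y => (hradt (σ j) Y).2) hij
  have hj : ∀ j : Fin 3, j ≠ j + 1 := by decide
  have hj' : ∀ j : Fin 3, j + 1 ≠ j := by decide
  have heq : ∀ j (k l : Fin 9), (k = oddIdx (σ j) ∨ k = evenIdx (σ j)) →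
      (l = oddIdx (σ (j + 1)) ∨ l = evenIdx (σ (j + 1))) →
      s * g (oddIdx j) k * g (evenIdx (j + 1)) l - g (evenIdx j) k * g (oddIdx (j + 1)) l =
        c (j + 2) * mu t (e k) (e l) (centIdx (σ (j + 2))) := by
    rintro j k l hk hl
    rw [← hσ, mu_apply_centIdx, hcol, hcol]
    rcases hk with rfl | rfl <;> rcases hl with rfl | rfl <;>
      simp [hodd _ _ (hj j), heven _ _ (hj j), hodd _ _ (hj' j), heven _ _ (hj' j)]
  have hmu : ∀ i : Fin 3,
      mu t (e (oddIdx i)) (e (oddIdx (i + 1))) (centIdx (i + 2)) = 0 ∧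
      mu t (e (evenIdx i)) (e (evenIdx (i + 1))) (centIdx (i + 2)) = 0 ∧
      mu t (e (oddIdx i)) (e (evenIdx (i + 1))) (centIdx (i + 2)) = t ∧
      mu t (e (evenIdx i)) (e (oddIdx (i + 1))) (centIdx (i + 2)) = -1 ∧
      mu t (e (oddIdx (i + 1))) (e (oddIdx i)) (centIdx (i + 2)) = 0 ∧
      mu t (e (evenIdx (i + 1))) (e (evenIdx i)) (centIdx (i + 2)) = 0 ∧
      mu t (e (oddIdx (i + 1))) (e (evenIdx i)) (centIdx (i + 2)) = 1 ∧
      mu t (e (evenIdx (i + 1))) (e (oddIdx i)) (centIdx (i + 2)) = -t := by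
    intro i
    simp only [mu_apply_centIdx]
    fin_cases i <;> simp [e, oddIdx, evenIdx]
  have ht0 : t ≠ 0 := by positivity
  rcases rotation_or_reflection σ hinj with hrot | href
  · have h2 : ∀ j, σ (j + 2) = σ j + 2 := by
      intro j
      rw [show j + 2 = j + 1 + 1 by fin_cases j <;> rfl, hrot, hrot, add_assoc]
      rfl
    have heq' := heq
    simp only [hrot, h2] at heq'
    refine eq_of_cycle ht hs (fun j => g (oddIdx j) (oddIdx (σ j)))
      (fun j => g (evenIdx j) (oddIdx (σ j))) (fun j => g (oddIdx j) (evenIdx (σ j)))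
      (fun j => g (evenIdx j) (evenIdx (σ j))) ?_ ?_ ?_ ?_ <;> intro j <;>
      simp only [hrot]
    · rw [heq' j _ _ (.inl rfl) (.inl rfl), (hmu _).1, mul_zero]
    · rw [heq' j _ _ (.inr rfl) (.inr rfl), (hmu _).2.1, mul_zero]
    · rw [heq' j _ _ (.inl rfl) (.inr rfl), heq' j _ _ (.inr rfl) (.inl rfl),
        (hmu _).2.2.1, (hmu _).2.2.2.1]
      ring
    · rw [heq' j _ _ (.inr rfl) (.inl rfl), (hmu _).2.2.2.1]
      simp [hc]
  · have h2 : ∀ j, σ (j + 2) = σ (j + 1) + 2 := by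
      intro j
      have h3 := href (j + 2)
      rw [show j + 2 + 1 = j by fin_cases j <;> rfl, href j] at h3
      rw [h3, add_assoc]
      rfl
    have heq' := heq
    simp only [h2] at heq'
    have hm := fun j => hmu (σ (j + 1))
    simp only [← href] at hm
    refine eq_of_cycle ht hs (fun j => g (oddIdx j) (evenIdx (σ j)))
      (fun j => g (evenIdx j) (evenIdx (σ j))) (fun j => g (oddIdx j) (oddIdx (σ j)))
      (fun j => g (evenIdx j) (oddIdx (σ j))) ?_ ?_ ?_ ?_ <;> intro j
    · rw [heq' j _ _ (.inr rfl) (.inr rfl), (hm j).2.2.2.2.2.1, mul_zero]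
    · rw [heq' j _ _ (.inl rfl) (.inl rfl), (hm j).2.2.2.2.1, mul_zero]
    · rw [heq' j _ _ (.inr rfl) (.inl rfl), heq' j _ _ (.inl rfl) (.inr rfl),
        (hm j).2.2.2.2.2.2.1, (hm j).2.2.2.2.2.2.2]
      ring
    · rw [heq' j _ _ (.inl rfl) (.inr rfl), (hm j).2.2.2.2.2.2.1]
      simp [hc]

/-- for `t,s ∈ (1,∞)`, `(ℝ⁹, μ_t) ≅ (ℝ⁹, μ_s)` iff `t = s`. -/
theorem statement8 (t s : ℝ) (ht : t ∈ Set.Ioi (1:ℝ)) (hs : s ∈ Set.Ioi (1:ℝ)) :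
    LieIso (mu t) (mu s) ↔ t = s := by
  constructor
  · rintro ⟨g, hunit, hg⟩
    have hdet := (Matrix.isUnit_iff_isUnit_det g).mp hunit
    have hgh := Matrix.mul_nonsing_inv g hdet
    have hhg := Matrix.nonsing_inv_mul g hdet
    exact eq_of_isBracketHom ht hs hg hgh hhg
  · rintro rfl
    exact ⟨1, isUnit_one, fun X Y => by simp⟩
end
end

section
/- For t, s ∈ (1,∞), if the Lie algebras ñ_t = (ℝ⁹, μ̃_t) and ñ_s = (ℝ⁹, μ̃_s) are isomorphic then t = s; hence {ñ_t : t ∈ (1,∞)} is a curve of pairwise non-isomorphic nilpotent Lie algebras. -/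
open Matrix Finset Real Filter

noncomputable section

theorem sum_fin_nine (f : Fin 9 → ℝ) :
    ∑ i, f i = f 0 + f 1 + f 2 + f 3 + f 4 + f 5 + f 6 + f 7 + f 8 := by
  rw [Fin.sum_univ_castSucc, Fin.sum_univ_eight]
  rfl

theorem muTilde_eq (t : ℝ) (X Y : Fin 9 → ℝ) :
    muTilde t X Y = ![0, 0, 0, 0, 0, 0,
      X 4 * Y 3 - X 3 * Y 4 + t * (X 2 * Y 5 - X 5 * Y 2) + (X 0 * Y 1 - X 1 * Y 0),
      X 0 * Y 5 - X 5 * Y 0 + t * (X 4 * Y 1 - X 1 * Y 4),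
      X 2 * Y 1 - X 1 * Y 2 + t * (X 0 * Y 3 - X 3 * Y 0)] := by
  funext k
  fin_cases k <;>
    simp [muTilde, muTildeC, muTildeHalf, muHalf, sum_fin_nine] <;> ring

/-- `g` is a homomorphism `(ℝ⁹, μ̃_t) → (ℝ⁹, μ̃_s)`. -/
def IsHom (t s : ℝ) (g : Matrix (Fin 9) (Fin 9) ℝ) : Prop :=
  ∀ X Y : Fin 9 → ℝ, g.mulVec (muTilde t X Y) = muTilde s (g.mulVec X) (g.mulVec Y)

theorem IsHom.inv {t s : ℝ} {g h : Matrix (Fin 9) (Fin 9) ℝ} (hg : IsHom t s g)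
    (hgh : g * h = 1) (hhg : h * g = 1) : IsHom s t h := by
  intro X Y
  have := hg (h.mulVec X) (h.mulVec Y)
  rw [mulVec_mulVec, mulVec_mulVec, hgh, one_mulVec, one_mulVec] at this
  rw [← this, mulVec_mulVec, hhg, one_mulVec]

theorem mulVec_muTilde (t : ℝ) (g : Matrix (Fin 9) (Fin 9) ℝ) (X Y : Fin 9 → ℝ) (k : Fin 9) :
    g.mulVec (muTilde t X Y) k =
      g k 6 * muTilde t X Y 6 + g k 7 * muTilde t X Y 7 + g k 8 * muTilde t X Y 8 := by
  simp [muTilde_eq, mulVec, dotProduct, sum_fin_nine]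

/-- The bracket relations between the columns of a homomorphism. -/
theorem IsHom.col {t s : ℝ} {g : Matrix (Fin 9) (Fin 9) ℝ} (hg : IsHom t s g) (i j k : Fin 9) :
    g k 6 * muTilde t (e i) (e j) 6 + g k 7 * muTilde t (e i) (e j) 7
      + g k 8 * muTilde t (e i) (e j) 8 = muTilde s (fun l => g l i) (fun l => g l j) k := by
  rw [← mulVec_muTilde, hg]
  congr 1 <;> (funext l; simp [e])

theorem IsHom.center {t s : ℝ} {g : Matrix (Fin 9) (Fin 9) ℝ} (hg : IsHom t s g) (k : Fin 9)
    (hk : k < 6) : g k 6 = 0 ∧ g k 7 = 0 ∧ g k 8 = 0 := by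
  have h6 := hg.col 4 3 k
  have h7 := hg.col 0 5 k
  have h8 := hg.col 2 1 k
  rw [muTilde_eq s] at h6 h7 h8
  have hk' : k = 0 ∨ k = 1 ∨ k = 2 ∨ k = 3 ∨ k = 4 ∨ k = 5 := by omega
  refine ⟨?_, ?_, ?_⟩
  · rcases hk' with rfl | rfl | rfl | rfl | rfl | rfl <;> simpa [muTilde_eq, e] using h6
  · rcases hk' with rfl | rfl | rfl | rfl | rfl | rfl <;> simpa [muTilde_eq, e] using h7
  · rcases hk' with rfl | rfl | rfl | rfl | rfl | rfl <;> simpa [muTilde_eq, e] using h8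

/-- The pullback of a form vanishing on `e₇` is singular, so the Pfaffian vanishes at it. -/
theorem IsHom.pfaffian {t s : ℝ} {g h : Matrix (Fin 9) (Fin 9) ℝ} (hs : 1 < s)
    (hg : IsHom t s g) (hgh : g * h = 1) (y z : ℝ) :
    (y * g 7 6 + z * g 8 6) * ((1 + t ^ 3) * (y * g 7 7 + z * g 8 7) * (y * g 7 8 + z * g 8 8)
      - t * (y * g 7 6 + z * g 8 6) ^ 2) = 0 := by
  set p := y * g 7 6 + z * g 8 6 with hp
  set q := y * g 7 7 + z * g 8 7 with hq
  set r := y * g 7 8 + z * g 8 8 with hr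
  by_contra hf
  set X : Fin 9 → ℝ := ![0, 0, s * y, 0, -z, 0, 0, 0, 0] with hX
  set u := h.mulVec X with hu
  have hgu : g.mulVec u = X := by rw [hu, mulVec_mulVec, hgh, one_mulVec]
  have key (Y : Fin 9 → ℝ) :
      p * muTilde t u Y 6 + q * muTilde t u Y 7 + r * muTilde t u Y 8 = 0 := by
    have h7 := congrFun (hg u Y) 7
    have h8 := congrFun (hg u Y) 8
    rw [mulVec_muTilde, hgu] at h7 h8
    have e7 : muTilde s X (g.mulVec Y) 7 = - s * z * (g.mulVec Y) 1 := by
      rw [muTilde_eq]; simp [hX]; ring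
    have e8 : muTilde s X (g.mulVec Y) 8 = s * y * (g.mulVec Y) 1 := by
      rw [muTilde_eq]; simp [hX]
    rw [e7] at h7
    rw [e8] at h8
    linear_combination y * h7 + z * h8
  have k0 := key (e 0)
  have k1 := key (e 1)
  have k2 := key (e 2)
  have k3 := key (e 3)
  have k4 := key (e 4)
  have k5 := key (e 5)
  simp [muTilde_eq, e] at k0 k1 k2 k3 k4 k5
  have u0 : u 0 = 0 := (mul_eq_zero.mp (by
    linear_combination (-t * p ^ 2) * k1 + t ^ 2 * p * q * k3 + r * p * k5 :
      _ * u 0 = 0)).resolve_left hf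
  have u2 : u 2 = 0 := (mul_eq_zero.mp (by
    linear_combination p * q * k1 - t * q ^ 2 * k3 + (t ^ 2 * q * r - p ^ 2) * k5 :
      _ * u 2 = 0)).resolve_left hf
  have u4 : u 4 = 0 := (mul_eq_zero.mp (by
    linear_combination t ^ 2 * p * r * k1 + (q * r - t * p ^ 2) * k3 - t * r ^ 2 * k5 :
      _ * u 4 = 0)).resolve_left hf
  have u1 : u 1 = 0 := (mul_eq_zero.mp (by
    linear_combination (t * p ^ 2) * k0 - p * q * k2 - t ^ 2 * p * r * k4 :
      _ * u 1 = 0)).resolve_left hf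
  have u3 : u 3 = 0 := (mul_eq_zero.mp (by
    linear_combination (-t ^ 2 * p * q) * k0 + t * q ^ 2 * k2 - (q * r - t * p ^ 2) * k4 :
      _ * u 3 = 0)).resolve_left hf
  have u5 : u 5 = 0 := (mul_eq_zero.mp (by
    linear_combination (-r * p) * k0 - (t ^ 2 * q * r - p ^ 2) * k2 + t * r ^ 2 * k4 :
      _ * u 5 = 0)).resolve_left hf
  have hX2 := congrFun hgu 2
  have hX4 := congrFun hgu 4
  obtain ⟨a1, a2, a3⟩ := hg.center 2 (by decide)
  obtain ⟨b1, b2, b3⟩ := hg.center 4 (by decide)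
  simp [mulVec, dotProduct, sum_fin_nine, hX, u0, u1, u2, u3, u4, u5, a1, a2, a3, b1, b2, b3]
    at hX2 hX4
  have hy : y = 0 := hX2.resolve_left (by linarith)
  apply hf
  simp [hp, hy, hX4]

/-- If a linear form times a nondegenerate quadratic form vanishes on a plane, then so does the
linear form. -/
theorem linear_eq_zero_of_mul_conic {t p q r p' q' r' a b c a' b' c' : ℝ} (ht : 1 < t)
    (h : ∀ y z : ℝ, (y * p + z * p') * ((1 + t ^ 3) * (y * q + z * q') * (y * r + z * r')
      - t * (y * p + z * p') ^ 2) = 0)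
    (h1 : p * a + q * b + r * c = 1) (h2 : p * a' + q * b' + r * c' = 0)
    (h4 : p' * a' + q' * b' + r' * c' = 1) :
    p = 0 ∧ p' = 0 := by
  have hT : (1 + t ^ 3) ≠ 0 := by positivity
  have e1 := h 1 0
  have e2 := h 0 1
  have e3 := h 1 1
  have e4 := h 1 (-1)
  by_contra hne
  have hquad : (1 + t ^ 3) * q * r = t * p ^ 2 ∧ (1 + t ^ 3) * q' * r' = t * p' ^ 2 ∧
      (1 + t ^ 3) * (q * r' + q' * r) = 2 * t * p * p' := by
    have f1 : p * ((1 + t ^ 3) * q * r - t * p ^ 2) = 0 := by linear_combination e1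
    have f2 : p' * ((1 + t ^ 3) * q' * r' - t * p' ^ 2) = 0 := by linear_combination e2
    have f3 : p * ((1 + t ^ 3) * (q * r' + q' * r) - 2 * t * p * p')
        + p' * ((1 + t ^ 3) * q * r - t * p ^ 2) = 0 := by
      linear_combination (e3 - e4) / 2 - f2
    have f4 : p' * ((1 + t ^ 3) * (q * r' + q' * r) - 2 * t * p * p')
        + p * ((1 + t ^ 3) * q' * r' - t * p' ^ 2) = 0 := by
      linear_combination (e3 + e4) / 2 - f1
    by_cases hp : p = 0
    · have hp' : p' ≠ 0 := fun h => hne ⟨hp, h⟩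
      subst hp
      have g2 := (mul_eq_zero.mp f2).resolve_left hp'
      have g3 : (1 + t ^ 3) * q * r = t * 0 ^ 2 :=
        mul_left_cancel₀ hp' (by linear_combination f3)
      have g4 : (1 + t ^ 3) * (q * r' + q' * r) = 2 * t * 0 * p' :=
        mul_left_cancel₀ hp' (by linear_combination f4)
      exact ⟨g3, by linear_combination g2, g4⟩
    · have g1 := (mul_eq_zero.mp f1).resolve_left hp
      have g3 : (1 + t ^ 3) * (q * r' + q' * r) = 2 * t * p * p' :=
        mul_left_cancel₀ hp (by linear_combination f3 - p' * g1)
      have g4 : (1 + t ^ 3) * q' * r' = t * p' ^ 2 :=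
        mul_left_cancel₀ hp (by linear_combination f4 - p' * g3)
      exact ⟨by linear_combination g1, g4, g3⟩
  obtain ⟨c1, c2, c3⟩ := hquad
  have hd : q * r' = q' * r := by
    have : (1 + t ^ 3) ^ 2 * (q * r' - q' * r) ^ 2 = 0 := by
      linear_combination ((1 + t ^ 3) * (q * r' + q' * r) + 2 * t * p * p') * c3
        - 4 * (1 + t ^ 3) * q' * r' * c1 - 4 * t * p ^ 2 * c2
    have := (mul_eq_zero.mp this).resolve_left (by positivity)
    have := pow_eq_zero_iff (two_ne_zero) |>.mp this
    linarith
  have ht0 : t ≠ 0 := by positivity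
  have x1 : (p * q' - p' * q) ^ 2 = 0 := by
    have : t * (p * q' - p' * q) ^ 2 = 0 := by
      linear_combination -q' ^ 2 * c1 - q ^ 2 * c2 + q * q' * c3
    exact (mul_eq_zero.mp this).resolve_left ht0
  have x2 : (p * r' - p' * r) ^ 2 = 0 := by
    have : t * (p * r' - p' * r) ^ 2 = 0 := by
      linear_combination -r' ^ 2 * c1 - r ^ 2 * c2 + r * r' * c3
    exact (mul_eq_zero.mp this).resolve_left ht0
  have x1 := pow_eq_zero_iff (two_ne_zero) |>.mp x1
  have x2 := pow_eq_zero_iff (two_ne_zero) |>.mp x2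
  have : (1 : ℝ) = 0 := by
    linear_combination -(p' * a' + q' * b' + r' * c') * h1 - h4
      + (p' * a + q' * b + r' * c) * h2 + (a * b' - a' * b) * x1
      + (a * c' - a' * c) * x2 + (b * c' - b' * c) * hd
  exact one_ne_zero this

theorem mul_apply_center {g h : Matrix (Fin 9) (Fin 9) ℝ} (hgh : g * h = 1) {j : Fin 9}
    (hj : ∀ k < 6, h k j = 0) (i : Fin 9) :
    g i 6 * h 6 j + g i 7 * h 7 j + g i 8 * h 8 j = (1 : Matrix (Fin 9) (Fin 9) ℝ) i j := by
  rw [← hgh, mul_apply, sum_fin_nine]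
  simp [hj]

/-- An isomorphism preserves the line spanned by `e₇`. -/
theorem IsHom.line {t s : ℝ} {g h : Matrix (Fin 9) (Fin 9) ℝ} (ht : 1 < t) (hs : 1 < s)
    (hg : IsHom t s g) (hh : IsHom s t h) (hgh : g * h = 1) : g 7 6 = 0 ∧ g 8 6 = 0 := by
  have h7 : ∀ k < 6, h k 7 = 0 := fun k hk => (hh.center k hk).2.1
  have h8 : ∀ k < 6, h k 8 = 0 := fun k hk => (hh.center k hk).2.2
  exact linear_eq_zero_of_mul_conic ht (hg.pfaffian hs hgh)
    (by simpa using mul_apply_center hgh h7 7) (by simpa using mul_apply_center hgh h8 7)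
    (by simpa using mul_apply_center hgh h8 8)

theorem IsHom.det_center_ne_zero {t s : ℝ} {g h : Matrix (Fin 9) (Fin 9) ℝ} (ht : 1 < t)
    (hs : 1 < s) (hg : IsHom t s g) (hh : IsHom s t h) (hgh : g * h = 1) :
    g 7 7 * g 8 8 - g 8 7 * g 7 8 ≠ 0 := by
  obtain ⟨l7, l8⟩ := hg.line ht hs hh hgh
  have h7 : ∀ k < 6, h k 7 = 0 := fun k hk => (hh.center k hk).2.1
  have h8 : ∀ k < 6, h k 8 = 0 := fun k hk => (hh.center k hk).2.2
  have e1 := mul_apply_center hgh h7 7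
  have e2 := mul_apply_center hgh h8 7
  have e3 := mul_apply_center hgh h7 8
  have e4 := mul_apply_center hgh h8 8
  simp [l7, l8] at e1 e2 e3 e4
  intro hd
  have : (1 : ℝ) = 0 := by
    linear_combination -(g 8 7 * h 7 8 + g 8 8 * h 8 8) * e1 - e4
      + (g 8 7 * h 7 7 + g 8 8 * h 8 7) * e2 + (h 7 7 * h 8 8 - h 7 8 * h 8 7) * hd
  exact one_ne_zero this

/-- A vector whose brackets satisfy a nontrivial linear relation modulo `e₇` lies in
`span(e₃,…,e₉)`. -/
theorem coord_eq_zero_of_relation {s y z : ℝ} (hs : 1 < s) {X : Fin 9 → ℝ}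
    (hyz : y ≠ 0 ∨ z ≠ 0)
    (h : ∀ Y, y * muTilde s X Y 7 + z * muTilde s X Y 8 = 0) : X 0 = 0 ∧ X 1 = 0 := by
  have k2 := h (e 2)
  have k3 := h (e 3)
  have k4 := h (e 4)
  have k5 := h (e 5)
  have hs0 : s ≠ 0 := by positivity
  simp [muTilde_eq, e, hs0] at k2 k3 k4 k5
  tauto

/-- An isomorphism preserves `span(e₃,…,e₉)`. -/
theorem IsHom.span_preserved {t s : ℝ} {g h : Matrix (Fin 9) (Fin 9) ℝ} (ht : 1 < t)
    (hs : 1 < s) (hg : IsHom t s g) (hh : IsHom s t h) (hgh : g * h = 1) :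
    ∀ k, 2 ≤ k → k < 6 → g 0 k = 0 ∧ g 1 k = 0 := by
  obtain ⟨l7, l8⟩ := hg.line ht hs hh hgh
  have hdet := hg.det_center_ne_zero ht hs hh hgh
  have rel (k : Fin 9) (Y : Fin 9 → ℝ) (i : Fin 9) :
      muTilde s (fun l => g l k) Y i = g i 6 * muTilde t (e k) (h.mulVec Y) 6
        + g i 7 * muTilde t (e k) (h.mulVec Y) 7 + g i 8 * muTilde t (e k) (h.mulVec Y) 8 := by
    rw [← mulVec_muTilde, hg, mulVec_mulVec, hgh, one_mulVec]
    congr 1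
    funext l
    simp [e]
  have main7 (k : Fin 9) (hk : ∀ Y, muTilde t (e k) Y 7 = 0) : g 0 k = 0 ∧ g 1 k = 0 := by
    refine coord_eq_zero_of_relation (X := fun l => g l k) (y := g 8 8) (z := - g 7 8)
      hs ?_ fun Y => ?_
    · by_contra! hc
      apply hdet
      rw [hc.1, neg_eq_zero.mp hc.2]; ring
    · rw [rel, rel, hk, l7, l8]; ring
  have main8 (k : Fin 9) (hk : ∀ Y, muTilde t (e k) Y 8 = 0) : g 0 k = 0 ∧ g 1 k = 0 := by
    refine coord_eq_zero_of_relation (X := fun l => g l k) (y := g 8 7) (z := - g 7 7)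
      hs ?_ fun Y => ?_
    · by_contra! hc
      apply hdet
      rw [hc.1, neg_eq_zero.mp hc.2]; ring
    · rw [rel, rel, hk, l7, l8]; ring
  intro k h2 h6
  have hk' : k = 2 ∨ k = 3 ∨ k = 4 ∨ k = 5 := by omega
  rcases hk' with rfl | rfl | rfl | rfl
  · exact main7 2 fun Y => by simp [muTilde_eq, e]
  · exact main7 3 fun Y => by simp [muTilde_eq, e]
  · exact main8 4 fun Y => by simp [muTilde_eq, e]
  · exact main8 5 fun Y => by simp [muTilde_eq, e]

theorem IsHom.det_top_ne_zero {t s : ℝ} {g h : Matrix (Fin 9) (Fin 9) ℝ} (ht : 1 < t)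
    (hs : 1 < s) (hg : IsHom t s g) (hh : IsHom s t h) (hgh : g * h = 1) :
    g 0 0 * g 1 1 - g 1 0 * g 0 1 ≠ 0 := by
  have hU := hg.span_preserved ht hs hh hgh
  have ent (i j : Fin 9) (hi : ∀ k, 2 ≤ k → g i k = 0) :
      g i 0 * h 0 j + g i 1 * h 1 j = (1 : Matrix (Fin 9) (Fin 9) ℝ) i j := by
    rw [← hgh, mul_apply, sum_fin_nine]
    simp [hi]
  have row (i : Fin 9) (hi : i = 0 ∨ i = 1) (k : Fin 9) (hk : 2 ≤ k) : g i k = 0 := by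
    obtain ⟨c6, c7, c8⟩ := hg.center i (by omega)
    by_cases h6 : k < 6
    · rcases hi with rfl | rfl
      exacts [(hU k hk h6).1, (hU k hk h6).2]
    · have : k = 6 ∨ k = 7 ∨ k = 8 := by omega
      rcases this with rfl | rfl | rfl <;> assumption
  have e1 := ent 0 0 (row 0 (by simp))
  have e2 := ent 0 1 (row 0 (by simp))
  have e3 := ent 1 0 (row 1 (by simp))
  have e4 := ent 1 1 (row 1 (by simp))
  simp at e1 e2 e3 e4
  intro hd
  have : (1 : ℝ) = 0 := by
    linear_combination -(g 1 0 * h 0 1 + g 1 1 * h 1 1) * e1 - e4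
      + (g 1 0 * h 0 0 + g 1 1 * h 1 0) * e2 + (h 0 0 * h 1 1 - h 0 1 * h 1 0) * hd
  exact one_ne_zero this

theorem scaled_form {s D w u2 u3 u4 u5 v2 v3 v4 v5 U2 U3 U4 U5 V2 V3 V4 V5 : ℝ}
    (h : w = u4 * v3 - u3 * v4 + s * (u2 * v5 - u5 * v2))
    (hu2 : D * u2 = U2) (hu3 : s * D * u3 = U3) (hu4 : s * D * u4 = U4) (hu5 : D * u5 = U5)
    (hv2 : D * v2 = V2) (hv3 : s * D * v3 = V3) (hv4 : s * D * v4 = V4) (hv5 : D * v5 = V5) :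
    s ^ 2 * D ^ 2 * w = U4 * V3 - U3 * V4 + s ^ 3 * (U2 * V5 - U5 * V2) := by
  subst h hu2 hu3 hu4 hu5 hv2 hv3 hv4 hv5
  ring

/-- The bracket relations on `span(e₃,…,e₆)` modulo change of basis determine the parameter. -/
theorem parameter_eq {t s m n u v : ℝ} (ht : 1 < t) (hs : 1 < s) (hmn : m - n ≠ 0)
    (huv : u - v ≠ 0) (h1 : m * n = 0) (h2 : u * v = 0)
    (h : (t ^ 3 - s ^ 3) * (u * m - v * n) = (1 - t ^ 3 * s ^ 3) * (v * m - u * n)) : t = s := by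
  have ht3 : 1 < t ^ 3 := one_lt_pow₀ ht (by norm_num)
  have hs3 : 1 < s ^ 3 := one_lt_pow₀ hs (by norm_num)
  have hne : 1 - t ^ 3 * s ^ 3 ≠ 0 := by nlinarith
  have key : (v * m - u * n) * (u * m - v * n) = 0 := by
    linear_combination (m ^ 2 + n ^ 2) * h2 - (u ^ 2 + v ^ 2) * h1
  have hpos : u * m - v * n ≠ 0 := by
    intro h0
    rw [h0, mul_zero] at h
    have h0' := (mul_eq_zero.mp h.symm).resolve_left hne
    have : (u - v) * (m + n) = 0 := by linear_combination h0 - h0'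
    have hm := (mul_eq_zero.mp this).resolve_left huv
    have : (m - n) * (u + v) = 0 := by linear_combination h0 + h0'
    have hu := (mul_eq_zero.mp this).resolve_left hmn
    apply hmn
    have : m ^ 2 = 0 := by linear_combination m * hm - h1
    have hm0 := pow_eq_zero_iff (two_ne_zero) |>.mp this
    linarith
  have h0 := (mul_eq_zero.mp key).resolve_right hpos
  rw [h0, mul_zero] at h
  have h3 := (mul_eq_zero.mp h).resolve_right hpos
  exact (pow_left_inj₀ (by positivity) (by positivity) three_ne_zero).mp (sub_eq_zero.mp h3)

/-- for `t,s ∈ (1,∞)`, if `ñ_t = (ℝ⁹, μ̃_t)` and `ñ_s = (ℝ⁹, μ̃_s)` are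
isomorphic Lie algebras then `t = s` (so the `ñ_t` are pairwise non-isomorphic). -/
theorem statement14 (t s : ℝ) (ht : t ∈ Set.Ioi (1:ℝ)) (hs : s ∈ Set.Ioi (1:ℝ))
    (h : LieIso (muTilde t) (muTilde s)) : t = s := by
  rw [Set.mem_Ioi] at ht hs
  obtain ⟨g, hu, hg : IsHom t s g⟩ := h
  have hgh : g * g⁻¹ = 1 := mul_nonsing_inv g ((isUnit_iff_isUnit_det g).mp hu)
  have hhg : g⁻¹ * g = 1 := nonsing_inv_mul g ((isUnit_iff_isUnit_det g).mp hu)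
  have hh := hg.inv hgh hhg
  have hB := hg.det_center_ne_zero ht hs hh hgh
  have hA := hg.det_top_ne_zero ht hs hh hgh
  obtain ⟨l7, l8⟩ := hg.line ht hs hh hgh
  have hU := hg.span_preserved ht hs hh hgh
  obtain ⟨z02, z12⟩ := hU 2 (by decide) (by decide)
  obtain ⟨z03, z13⟩ := hU 3 (by decide) (by decide)
  obtain ⟨z04, z14⟩ := hU 4 (by decide) (by decide)
  obtain ⟨z05, z15⟩ := hU 5 (by decide) (by decide)
  have q057 := hg.col 0 5 7
  have q058 := hg.col 0 5 8
  have q157 := hg.col 1 5 7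
  have q158 := hg.col 1 5 8
  have q047 := hg.col 0 4 7
  have q048 := hg.col 0 4 8
  have q147 := hg.col 1 4 7
  have q148 := hg.col 1 4 8
  have q037 := hg.col 0 3 7
  have q038 := hg.col 0 3 8
  have q137 := hg.col 1 3 7
  have q138 := hg.col 1 3 8
  have q027 := hg.col 0 2 7
  have q028 := hg.col 0 2 8
  have q127 := hg.col 1 2 7
  have q128 := hg.col 1 2 8
  have w43 := hg.col 4 3 6
  have w25 := hg.col 2 5 6
  have w23 := hg.col 2 3 6
  have w24 := hg.col 2 4 6
  have w35 := hg.col 3 5 6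
  have w45 := hg.col 4 5 6
  simp [muTilde_eq, e, z02, z12, z03, z13, z04, z14, z05, z15]
    at q057 q058 q157 q158 q047 q048 q147 q148 q037 q038 q137 q138 q027 q028 q127 q128
      w43 w25 w23 w24 w35 w45
  set D := g 0 0 * g 1 1 - g 1 0 * g 0 1 with hD
  have x54 : s * D * g 4 5 = g 0 1 * (g 7 7) := by
    linear_combination g 0 0 * q157 - g 0 1 * q057
  have x55 : D * g 5 5 = g 1 1 * (g 7 7) := by
    linear_combination -g 1 1 * q057 + g 1 0 * q157
  have x53 : s * D * g 3 5 = g 1 1 * (g 8 7) := by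
    linear_combination -g 1 1 * q058 + g 1 0 * q158
  have x52 : D * g 2 5 = g 0 1 * (g 8 7) := by
    linear_combination g 0 0 * q158 - g 0 1 * q058
  have x44 : s * D * g 4 4 = -g 0 0 * (-(g 7 7 * t)) := by
    linear_combination g 0 0 * q147 - g 0 1 * q047
  have x45 : D * g 5 4 = -g 1 0 * (-(g 7 7 * t)) := by
    linear_combination -g 1 1 * q047 + g 1 0 * q147
  have x43 : s * D * g 3 4 = -g 1 0 * (-(g 8 7 * t)) := by
    linear_combination -g 1 1 * q048 + g 1 0 * q148
  have x42 : D * g 2 4 = -g 0 0 * (-(g 8 7 * t)) := by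
    linear_combination g 0 0 * q148 - g 0 1 * q048
  have x34 : s * D * g 4 3 = g 0 1 * (g 7 8 * t) := by
    linear_combination g 0 0 * q137 - g 0 1 * q037
  have x35 : D * g 5 3 = g 1 1 * (g 7 8 * t) := by
    linear_combination -g 1 1 * q037 + g 1 0 * q137
  have x33 : s * D * g 3 3 = g 1 1 * (g 8 8 * t) := by
    linear_combination -g 1 1 * q038 + g 1 0 * q138
  have x32 : D * g 2 3 = g 0 1 * (g 8 8 * t) := by
    linear_combination g 0 0 * q138 - g 0 1 * q038
  have x24 : s * D * g 4 2 = -g 0 0 * (-g 7 8) := by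
    linear_combination g 0 0 * q127 - g 0 1 * q027
  have x25 : D * g 5 2 = -g 1 0 * (-g 7 8) := by
    linear_combination -g 1 1 * q027 + g 1 0 * q127
  have x23 : s * D * g 3 2 = -g 1 0 * (-g 8 8) := by
    linear_combination -g 1 1 * q028 + g 1 0 * q128
  have x22 : D * g 2 2 = -g 0 0 * (-g 8 8) := by
    linear_combination g 0 0 * q128 - g 0 1 * q028
  have y43 := scaled_form w43 x42 x43 x44 x45
    x32 x33 x34 x35
  have y25 := scaled_form w25 x22 x23 x24 x25
    x52 x53 x54 x55
  have y23 := scaled_form w23 x22 x23 x24 x25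
    x32 x33 x34 x35
  have y24 := scaled_form w24 x22 x23 x24 x25
    x42 x43 x44 x45
  have y35 := scaled_form w35 x32 x33 x34 x35
    x52 x53 x54 x55
  have y45 := scaled_form w45 x42 x43 x44 x45
    x52 x53 x54 x55
  have hs3 : 1 < s ^ 3 := one_lt_pow₀ hs (by norm_num)
  have ht0 : t ≠ 0 := by positivity
  have hc : t * (s ^ 3 - 1) * (g 7 7 * g 8 8 - g 8 7 * g 7 8) ≠ 0 :=
    mul_ne_zero (mul_ne_zero ht0 (by linarith)) hB
  have hc' : (1 + s ^ 3) * D ≠ 0 := mul_ne_zero (by positivity) hA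
  have a0 : g 0 0 * g 1 0 = 0 := by
    refine (mul_eq_zero.mp (?_ : _ * (g 0 0 * g 1 0) = 0)).resolve_left hc
    linear_combination -y24
  have a1 : g 0 1 * g 1 1 = 0 := by
    refine (mul_eq_zero.mp (?_ : _ * (g 0 1 * g 1 1) = 0)).resolve_left hc
    linear_combination -y35
  have b0 : g 7 8 * g 8 8 = 0 := by
    refine (mul_eq_zero.mp (?_ : t * ((1 + s ^ 3) * D) * (g 7 8 * g 8 8) = 0)).resolve_left
      (mul_ne_zero ht0 hc')
    linear_combination -y23
  have b1 : g 7 7 * g 8 7 = 0 := by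
    refine (mul_eq_zero.mp (?_ : t * ((1 + s ^ 3) * D) * (g 7 7 * g 8 7) = 0)).resolve_left
      (mul_ne_zero ht0 hc')
    linear_combination -y45
  refine parameter_eq ht hs hA hB ?_ ?_ ?_
  · linear_combination g 1 1 * g 0 1 * a0
  · linear_combination g 8 8 * g 7 8 * b1
  · linear_combination y25 - t * y43
end
end

section
/- For every t ∈ (1,∞), n̄_t = (ℝ⁹, μ̄_t) is not an Einstein nilradical: for every g ∈ GL₉(ℝ), writing ν = g·μ̄_t, there exist no c ∈ ℝ and no derivation D of (ℝ⁹, ν) with Ric_ν = c·I + D. -/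
open Matrix Finset Real Filter

noncomputable section

/-- The bilinear bracket with structure constants `C`. -/
def ofConsts (C : Fin 9 → Fin 9 → Fin 9 → ℝ) : NilBracket :=
  fun X Y k => ∑ i, ∑ j, X i * Y j * C i j k

/-- The structure constants of `g · μ`, where `μ` has structure constants `C`. -/
def actConsts (g : Matrix (Fin 9) (Fin 9) ℝ) (C : Fin 9 → Fin 9 → Fin 9 → ℝ) :
    Fin 9 → Fin 9 → Fin 9 → ℝ :=
  fun i j k => ∑ c, ∑ a, ∑ b, g k c * (g⁻¹ a i * g⁻¹ b j * C a b c)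

/-- The flag index of each basis vector; the flag is preserved by all derivations of `μ̄_t`. -/
def flagIndex : Fin 9 → ℕ := ![3, 3, 3, 3, 2, 2, 0, 0, 1]

/-- The weights of the one-parameter group degenerating `μ̄_t` to `μ_t`. -/
def weight : Fin 9 → ℤ := ![-1, -1, -1, -1, 2, 2, 1, 1, -2]

/-- The diagonal matrix of the weights. -/
def weightMatrix : Matrix (Fin 9) (Fin 9) ℝ := diagonal fun i => (weight i : ℝ)

theorem muBar_eq_ofConsts (t : ℝ) : muBar t = ofConsts (muBarC t) := rfl

theorem ofConsts_e (C : Fin 9 → Fin 9 → Fin 9 → ℝ) (i j k : Fin 9) :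
    ofConsts C (e i) (e j) k = C i j k := by
  simp [ofConsts, e, Pi.single_apply]

theorem ofConsts_eq_dotProduct (C : Fin 9 → Fin 9 → Fin 9 → ℝ) (X Y : Fin 9 → ℝ) (k : Fin 9) :
    ofConsts C X Y k = X ⬝ᵥ (of fun i j => C i j k) *ᵥ Y := by
  simp [ofConsts, dotProduct, mulVec, Finset.mul_sum, mul_left_comm, mul_comm]

theorem act_ofConsts (g : Matrix (Fin 9) (Fin 9) ℝ) (C : Fin 9 → Fin 9 → Fin 9 → ℝ) :
    act g (ofConsts C) = ofConsts (actConsts g C) := by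
  ext X Y k
  have hC : (of fun i j => actConsts g C i j k) =
      ∑ c, g k c • (g⁻¹ᵀ * (of fun i j => C i j c) * g⁻¹) := by
    ext i j
    simp only [actConsts, of_apply, Matrix.sum_apply, Matrix.smul_apply, mul_apply, transpose_apply,
      smul_eq_mul, Finset.mul_sum, Finset.sum_mul]
    refine Finset.sum_congr rfl fun c _ => ?_
    rw [Finset.sum_comm]
    refine Finset.sum_congr rfl fun b _ => Finset.sum_congr rfl fun a _ => ?_
    ring
  rw [ofConsts_eq_dotProduct, hC, sum_mulVec, dotProduct_sum]
  simp only [act, mulVec_apply, smul_mulVec, dotProduct_smul, smul_eq_mul]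
  refine Finset.sum_congr rfl fun c _ => ?_
  rw [ofConsts_eq_dotProduct, ← mulVec_mulVec, ← mulVec_mulVec, dotProduct_mulVec X,
    vecMul_transpose, row_apply]

theorem act_mul (k g : Matrix (Fin 9) (Fin 9) ℝ) (μ : NilBracket) :
    act (k * g) μ = act k (act g μ) := by
  ext X Y c
  simp [act, Matrix.mul_inv_rev, mulVec_mulVec]

theorem IsDerivation.of_act {g D : Matrix (Fin 9) (Fin 9) ℝ} {μ : NilBracket} (hg : IsUnit g)
    (hD : IsDerivation (act g μ) D) : IsDerivation μ (g⁻¹ * D * g) := by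
  have hdet := (isUnit_iff_isUnit_det g).1 hg
  intro X Y
  have h := congrArg (g⁻¹ *ᵥ ·) (hD (g *ᵥ X) (g *ᵥ Y))
  simpa [act, mulVec_add, mulVec_mulVec, ← Matrix.mul_assoc, nonsing_inv_mul _ hdet] using h

theorem exists_orthogonal_mul_blockTriangular {n : ℕ} {α : Type*} [LinearOrder α] (b : Fin n → α)
    (g : Matrix (Fin n) (Fin n) ℝ) :
    ∃ k p : Matrix (Fin n) (Fin n) ℝ, kᵀ * k = 1 ∧ g = k * p ∧ p.BlockTriangular b := by
  let f : Fin n → EuclideanSpace ℝ (Fin n) := fun j => WithLp.toLp 2 (g.col (Tuple.sort b j))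
  let B := InnerProductSpace.gramSchmidtOrthonormalBasis (𝕜 := ℝ) (by simp) f
  let k : Matrix (Fin n) (Fin n) ℝ := of fun i j => B ((Tuple.sort b).symm j) i
  have hk : kᵀ * k = 1 := by
    ext i j
    have := B.inner_eq_ite ((Tuple.sort b).symm i) ((Tuple.sort b).symm j)
    simpa [k, mul_apply, PiLp.inner_apply, one_apply, mul_comm] using this
  refine ⟨k, kᵀ * g, hk, ?_, fun i j hij => ?_⟩
  · rw [← Matrix.mul_assoc, mul_eq_one_comm.1 hk, Matrix.one_mul]
  · have hlt : (Tuple.sort b).symm j < (Tuple.sort b).symm i := by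
      by_contra! h
      have := Tuple.monotone_sort b h
      simp only [Function.comp_apply, Equiv.apply_symm_apply] at this
      exact this.not_gt hij
    have := InnerProductSpace.gramSchmidtOrthonormalBasis_inv_triangular (𝕜 := ℝ) (by simp) f hlt
    simpa [f, k, B, mul_apply, PiLp.inner_apply, mul_comm] using this

theorem trace_mul_mul_diagonal_comm {n α : Type*} [Fintype n] [DecidableEq n] [LinearOrder α]
    {b : n → α} {M N : Matrix n n ℝ} (hM : M.BlockTriangular b) (hN : N.BlockTriangular b)
    {d : n → ℝ} (hd : ∀ i j, b i = b j → d i = d j) :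
    (M * N * diagonal d).trace = (N * M * diagonal d).trace := by
  simp only [trace, diag_apply, mul_diagonal]
  simp only [mul_apply, Finset.sum_mul]
  rw [Finset.sum_comm]
  refine Finset.sum_congr rfl fun i _ => Finset.sum_congr rfl fun j _ => ?_
  rcases lt_trichotomy (b i) (b j) with h | h | h
  · simp [hM h]
  · rw [hd i j h, mul_comm (M j i)]
  · simp [hN h]

theorem trace_ric_mul_diagonal {C : Fin 9 → Fin 9 → Fin 9 → ℝ} (hC : ∀ i j k, C i j k = -C j i k)
    (d : Fin 9 → ℝ) : (ric (ofConsts C) * diagonal d).trace =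
      1 / 4 * ∑ i, ∑ j, ∑ k, (d k - d i - d j) * C i j k ^ 2 := by
  have h₁ : ∑ i, ∑ j, ∑ k, d j * C i j k ^ 2 = ∑ i, ∑ j, ∑ k, d i * C i j k ^ 2 := by
    rw [Finset.sum_comm]
    refine Finset.sum_congr rfl fun i _ => Finset.sum_congr rfl fun j _ =>
      Finset.sum_congr rfl fun k _ => ?_
    rw [hC j i k, neg_sq]
  have h₂ : ∑ i, ∑ j, ∑ k, d k * C i j k ^ 2 = ∑ a, ∑ i, ∑ j, d a * C i j a ^ 2 := by
    rw [Finset.sum_congr rfl fun i _ => Finset.sum_comm, Finset.sum_comm]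
  simp only [trace, diag_apply, mul_diagonal, ric, ofConsts_e, sub_mul, Finset.sum_sub_distrib, h₁,
    h₂, ← pow_two, add_mul, Finset.sum_add_distrib]
  simp only [mul_assoc, ← Finset.mul_sum, Finset.sum_mul, mul_comm (d _)]
  ring

/-- The Ricci operator is equivariant under orthogonal transformations. -/
theorem ric_act_ofConsts {k : Matrix (Fin 9) (Fin 9) ℝ} (hk : kᵀ * k = 1)
    (C : Fin 9 → Fin 9 → Fin 9 → ℝ) :
    ric (act k (ofConsts C)) = k * ric (ofConsts C) * kᵀ := by
  let P (C : Fin 9 → Fin 9 → Fin 9 → ℝ) : Matrix (Fin 9) (Fin 9 × Fin 9) ℝ :=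
    of fun a x => C a x.1 x.2
  let Q (C : Fin 9 → Fin 9 → Fin 9 → ℝ) : Matrix (Fin 9) (Fin 9 × Fin 9) ℝ :=
    of fun a x => C x.1 x.2 a
  have hric (C) : ric (ofConsts C) = (-(1 / 2) : ℝ) • (P C * (P C)ᵀ) +
      (1 / 4 : ℝ) • (Q C * (Q C)ᵀ) := by
    ext a b
    simp [ric, ofConsts_e, P, Q, mul_apply, Fintype.sum_prod_type]
  have hinv : k⁻¹ = kᵀ := inv_eq_left_inv hk
  have hP : P (actConsts k C) = k * P C * (kroneckerMap (· * ·) kᵀ kᵀ) := by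
    ext a ⟨i, j⟩
    simp only [P, actConsts, hinv, of_apply, mul_apply, Fintype.sum_prod_type, Finset.sum_mul,
      kroneckerMap_apply, transpose_apply]
    rw [Finset.sum_congr rfl fun c _ => Finset.sum_comm, Finset.sum_comm]
    refine Finset.sum_congr rfl fun _ _ => Finset.sum_congr rfl fun _ _ =>
      Finset.sum_congr rfl fun _ _ => ?_
    ring
  have hQ : Q (actConsts k C) = k * Q C * (kroneckerMap (· * ·) kᵀ kᵀ) := by
    ext a ⟨i, j⟩
    simp only [Q, actConsts, hinv, of_apply, mul_apply, Fintype.sum_prod_type, Finset.sum_mul,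
      kroneckerMap_apply, transpose_apply]
    rw [Finset.sum_comm, Finset.sum_congr rfl fun x _ => Finset.sum_comm]
    refine Finset.sum_congr rfl fun _ _ => Finset.sum_congr rfl fun _ _ =>
      Finset.sum_congr rfl fun _ _ => ?_
    ring
  have hK : kroneckerMap (· * ·) kᵀ kᵀ * (kroneckerMap (· * ·) kᵀ kᵀ)ᵀ = 1 := by
    rw [← kroneckerMap_transpose, transpose_transpose, ← mul_kronecker_mul, hk, one_kronecker_one]
  have hR (M : Matrix (Fin 9) (Fin 9 × Fin 9) ℝ) :
      k * M * kroneckerMap (· * ·) kᵀ kᵀ * (k * M * kroneckerMap (· * ·) kᵀ kᵀ)ᵀ =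
        k * (M * Mᵀ) * kᵀ := by
    rw [transpose_mul, Matrix.mul_assoc, ← Matrix.mul_assoc _ _ (k * M)ᵀ, hK, Matrix.one_mul,
      transpose_mul]
    simp only [Matrix.mul_assoc]
  rw [act_ofConsts, hric, hric, hP, hQ, hR, hR]
  simp [Matrix.mul_add, Matrix.add_mul]

theorem isDerivation_ofConsts_diagonal {C : Fin 9 → Fin 9 → Fin 9 → ℝ} {d : Fin 9 → ℝ}
    (h : ∀ i j k, (d k - d i - d j) * C i j k = 0) : IsDerivation (ofConsts C) (diagonal d) := by
  intro X Y
  ext k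
  simp only [mulVec_diagonal, ofConsts, Pi.add_apply, Finset.mul_sum, ← Finset.sum_add_distrib]
  refine Finset.sum_congr rfl fun i _ => Finset.sum_congr rfl fun j _ => ?_
  linear_combination X i * Y j * h i j k

theorem muBarC_eq_zero (t : ℝ) {i j k : Fin 9}
    (h : flagIndex i + flagIndex j < 5 + flagIndex k) : muBarC t i j k = 0 := by
  have hz (a b c : Fin 9) (habc : 5 + flagIndex c ≤ flagIndex a + flagIndex b) (v : ℝ) :
      (if i = a ∧ j = b ∧ k = c then v else 0) = 0 ∧
        (if j = a ∧ i = b ∧ k = c then v else 0) = 0 := by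
    constructor <;> refine if_neg ?_ <;> rintro ⟨rfl, rfl, rfl⟩ <;> omega
  simp only [muBarC, muBarHalf, muTildeHalf, muHalf]
  rw [(hz 4 3 6 (by decide) 1).1, (hz 4 3 6 (by decide) 1).2,
    (hz 0 5 7 (by decide) 1).1, (hz 0 5 7 (by decide) 1).2,
    (hz 2 1 8 (by decide) 1).1, (hz 2 1 8 (by decide) 1).2,
    (hz 2 5 6 (by decide) t).1, (hz 2 5 6 (by decide) t).2,
    (hz 4 1 7 (by decide) t).1, (hz 4 1 7 (by decide) t).2,
    (hz 0 3 8 (by decide) t).1, (hz 0 3 8 (by decide) t).2,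
    (hz 0 1 6 (by decide) 1).1, (hz 0 1 6 (by decide) 1).2,
    (hz 2 3 7 (by decide) 1).1, (hz 2 3 7 (by decide) 1).2]
  simp

theorem weight_le {i j k : Fin 9} (h : 5 + flagIndex k ≤ flagIndex i + flagIndex j) :
    weight i + weight j ≤ weight k := by
  revert i j k
  decide

theorem actConsts_muBarC_eq_zero (t : ℝ) {p : Matrix (Fin 9) (Fin 9) ℝ}
    (hp : p.BlockTriangular flagIndex) (hp' : p⁻¹.BlockTriangular flagIndex) {i j k : Fin 9}
    (h : flagIndex i + flagIndex j < 5 + flagIndex k) : actConsts p (muBarC t) i j k = 0 := by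
  refine Finset.sum_eq_zero fun c _ => Finset.sum_eq_zero fun a _ => Finset.sum_eq_zero fun b _ =>
    ?_
  rcases lt_or_ge (flagIndex c) (flagIndex k) with hc | hc
  · simp [hp hc]
  rcases lt_or_ge (flagIndex i) (flagIndex a) with ha | ha
  · simp [hp' ha]
  rcases lt_or_ge (flagIndex j) (flagIndex b) with hb | hb
  · simp [hp' hb]
  simp [muBarC_eq_zero t (show flagIndex a + flagIndex b < 5 + flagIndex c by omega)]

theorem actConsts_muBarC_skew (t : ℝ) (g : Matrix (Fin 9) (Fin 9) ℝ) (i j k : Fin 9) :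
    actConsts g (muBarC t) i j k = -actConsts g (muBarC t) j i k := by
  simp only [actConsts, ← Finset.sum_neg_distrib]
  refine Finset.sum_congr rfl fun c _ => ?_
  rw [Finset.sum_comm]
  refine Finset.sum_congr rfl fun a _ => Finset.sum_congr rfl fun b _ => ?_
  simp only [muBarC]
  ring

theorem IsDerivation.ofConsts_apply {C : Fin 9 → Fin 9 → Fin 9 → ℝ}
    {D : Matrix (Fin 9) (Fin 9) ℝ} (hD : IsDerivation (ofConsts C) D) (a b k : Fin 9) :
    ∑ m, D k m * C a b m = ∑ m, D m a * C m b k + ∑ m, D m b * C a m k := by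
  have h := congrFun (hD (e a) (e b)) k
  rw [Pi.add_apply] at h
  simpa [mulVec, dotProduct, ofConsts_e, ofConsts, e, Pi.single_apply] using h

/-- The derivations of `μ̄_t` are block triangular with respect to the flag, and they are
orthogonal to the weight matrix for the trace form. -/
theorem IsDerivation.blockTriangular_and_trace_eq_zero {t : ℝ} (ht : 1 < t)
    {D : Matrix (Fin 9) (Fin 9) ℝ} (hD : IsDerivation (muBar t) D) :
    D.BlockTriangular flagIndex ∧ (D * weightMatrix).trace = 0 := by
  have h := IsDerivation.ofConsts_apply (C := muBarC t) hD
  have ht0 : t ≠ 0 := by positivity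
  have ht3 : 1 + t ^ 3 ≠ 0 := by positivity
  simp only [muBarC, muBarHalf, muTildeHalf, muHalf] at h
  -- `habk` is the `k`-th component of the derivation identity for `e a` and `e b`
  have h016 := h 0 1 6
  have h057 := h 0 5 7
  have h417 := h 4 1 7
  have h237 := h 2 3 7
  have h218 := h 2 1 8
  have h038 := h 0 3 8
  have h436 := h 4 3 6
  have h256 := h 2 5 6
  have h048 := h 0 4 8
  have h058 := h 0 5 8
  have h148 := h 1 4 8
  have h456 := h 4 5 6
  have h158 := h 1 5 8
  have h358 := h 3 5 8
  have h248 := h 2 4 8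
  have h258 := h 2 5 8
  have h348 := h 3 4 8
  have h457 := h 4 5 7
  simp at h016 h057 h417 h237 h218 h038 h436 h256
  simp [ht0] at h048 h058 h148 h456 h158 h358 h248 h258 h348 h457
  have hcenter (c : Fin 9) (hc : c = 6 ∨ c = 7 ∨ c = 8) :
      D 0 c = 0 ∧ D 1 c = 0 ∧ D 2 c = 0 ∧ D 3 c = 0 ∧ D 4 c = 0 ∧ D 5 c = 0 := by
    have h06 := h 0 c 6
    have h07 := h 0 c 7
    have h08 := h 0 c 8
    have h16 := h 1 c 6
    have h17 := h 1 c 7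
    have h18 := h 1 c 8
    rcases hc with rfl | rfl | rfl <;>
      simp [ht0] at h06 h07 h08 h16 h17 h18 <;>
      exact ⟨h16, h06.symm, h18, h08, h17, h07.symm⟩
  have h87 : D 8 7 = 0 := by
    have : (1 + t ^ 3) * D 8 7 = 0 := by linear_combination h058 - t * h456 + t ^ 2 * h148
    exact (mul_eq_zero.1 this).resolve_left ht3
  have h86 : D 8 6 = 0 := by
    have : (1 + t ^ 3) * D 8 6 = 0 := by linear_combination h348 - t * h457 + t ^ 2 * h258
    exact (mul_eq_zero.1 this).resolve_left ht3
  have h24 : D 2 4 = 0 := by rw [← h148, h87, zero_mul]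
  have h15 : D 1 5 = 0 := by rw [← h258, h86, zero_mul]
  have h35 : D 3 5 = 0 := by linear_combination -h456 - t * h24
  have h04 : D 0 4 = 0 := by linear_combination -h457 - t * h15
  obtain ⟨h06, h16, h26, h36, h46, h56⟩ := hcenter 6 (by simp)
  obtain ⟨h07, h17, h27, h37, h47, h57⟩ := hcenter 7 (by simp)
  obtain ⟨h08, h18, h28, h38, h48, h58⟩ := hcenter 8 (by simp)
  refine ⟨fun i j hij => ?_, ?_⟩
  · fin_cases i <;> fin_cases j <;>
      first
      | exact absurd hij (by decide)
      | assumption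
      | exact h248.symm
  · have e₁ : D 7 7 = D 4 4 + D 1 1 := mul_right_cancel₀ ht0 (by linear_combination h417)
    have e₂ : D 8 8 = D 0 0 + D 3 3 := mul_right_cancel₀ ht0 (by linear_combination h038)
    have e₃ : D 6 6 = D 2 2 + D 5 5 := mul_right_cancel₀ ht0 (by linear_combination h256)
    simp [weightMatrix, trace, weight, Fin.sum_univ_succ]
    linarith

/-- for `t ∈ (1,∞)`, `n̄_t = (ℝ⁹, μ̄_t)` is not an Einstein nilradical:
for every `g ∈ GL₉(ℝ)`, the bracket `ν = g·μ̄_t` admits no `c ∈ ℝ` and derivation `D`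
with `Ric_ν = c·I + D`. -/
theorem statement19 (t : ℝ) (ht : t ∈ Set.Ioi (1:ℝ)) :
    ∀ g : Matrix (Fin 9) (Fin 9) ℝ, IsUnit g →
      ¬ ∃ (c : ℝ) (D : Matrix (Fin 9) (Fin 9) ℝ),
        IsDerivation (act g (muBar t)) D ∧
        ric (act g (muBar t)) = c • (1 : Matrix (Fin 9) (Fin 9) ℝ) + D := by
  rintro g hg ⟨c, D, hD, hric⟩
  obtain ⟨k, p, hk, rfl, hp⟩ := exists_orthogonal_mul_blockTriangular flagIndex g
  have hku : IsUnit k := (isUnit_iff_isUnit_det k).2 (isUnit_det_of_left_inverse hk)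
  have hpu : IsUnit p := by
    have := (isUnit_iff_isUnit_det _).1 hg
    rw [det_mul] at this
    exact (isUnit_iff_isUnit_det p).2 (isUnit_of_mul_isUnit_right this)
  have hinv : k⁻¹ = kᵀ := inv_eq_left_inv hk
  have hp' : p⁻¹.BlockTriangular flagIndex := by
    let := hpu.invertible
    exact blockTriangular_inv_of_blockTriangular hp
  have hflag : ∀ i j : Fin 9, flagIndex i = flagIndex j → (weight i : ℝ) = weight j := by
    have : ∀ i j : Fin 9, flagIndex i = flagIndex j → weight i = weight j := by decide
    exact fun i j h => congrArg _ (this i j h)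
  have htrace {M : Matrix (Fin 9) (Fin 9) ℝ} (hM : IsDerivation (act p (muBar t)) M) :
      (M * weightMatrix).trace = 0 := by
    obtain ⟨hT, h0⟩ := (hM.of_act hpu).blockTriangular_and_trace_eq_zero ht
    have hpdet := (isUnit_iff_isUnit_det p).1 hpu
    have h := trace_mul_mul_diagonal_comm hp (hT.mul hp') hflag
    rw [show p * (p⁻¹ * M * p * p⁻¹) = M by
        rw [mul_nonsing_inv_cancel_right _ _ hpdet, mul_nonsing_inv_cancel_left _ _ hpdet],
      nonsing_inv_mul_cancel_right _ _ hpdet] at h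
    exact h.trans h0
  set N := actConsts p (muBarC t) with hN
  have hact : act p (muBar t) = ofConsts N := by rw [muBar_eq_ofConsts, act_ofConsts]
  rw [act_mul, hact] at hD hric
  rw [hact] at htrace
  have hricp : ric (ofConsts N) = c • (1 : Matrix (Fin 9) (Fin 9) ℝ) + k⁻¹ * D * k := by
    have h := congrArg (fun M => kᵀ * M * k) hric
    rw [ric_act_ofConsts hk] at h
    simp only [Matrix.mul_assoc, hk, Matrix.mul_one] at h
    rw [← Matrix.mul_assoc, hk, Matrix.one_mul] at h
    rw [h, hinv]
    simp [Matrix.mul_add, Matrix.add_mul, Matrix.mul_assoc, hk]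
  have hzero : (ric (ofConsts N) * weightMatrix).trace = 0 := by
    rw [hricp, Matrix.add_mul, trace_add, htrace (hD.of_act hku)]
    simp [weightMatrix, weight, Fin.sum_univ_succ]
    norm_num
  have hnonneg (i j k : Fin 9) : 0 ≤ ((weight k : ℝ) - weight i - weight j) * N i j k ^ 2 := by
    rcases lt_or_ge (flagIndex i + flagIndex j) (5 + flagIndex k) with h | h
    · simp [hN, actConsts_muBarC_eq_zero t hp hp' h]
    · have : (weight i : ℝ) + weight j ≤ weight k := mod_cast weight_le h
      exact mul_nonneg (by linarith) (sq_nonneg _)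
  have hweight (i j k : Fin 9) : ((weight k : ℝ) - weight i - weight j) * N i j k = 0 := by
    rw [weightMatrix, trace_ric_mul_diagonal (actConsts_muBarC_skew t p)] at hzero
    have h := (mul_eq_zero.1 hzero).resolve_left (by norm_num)
    rw [Finset.sum_eq_zero_iff_of_nonneg fun i _ => Finset.sum_nonneg fun j _ =>
      Finset.sum_nonneg fun k _ => hnonneg i j k] at h
    replace h := h i (mem_univ i)
    rw [Finset.sum_eq_zero_iff_of_nonneg fun j _ => Finset.sum_nonneg fun k _ => hnonneg i j k] at h
    replace h := h j (mem_univ j)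
    rw [Finset.sum_eq_zero_iff_of_nonneg fun k _ => hnonneg i j k] at h
    simpa using h k (mem_univ k)
  have h := htrace (isDerivation_ofConsts_diagonal hweight)
  simp [weightMatrix, weight, Fin.sum_univ_succ] at h
  norm_num at h
end
end
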